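/- Let p ∈ ℝ³ and let û : ℝ³ → ℝ be twice continuously differentiable at p (ContDiffAt ℝ 2 û p). Let e₂ and e₃ denote the second and third standard basis vectors of ℝ³. Suppose g₁, g₂ : ℝ → ℝ satisfy g₁(h) = û(p + h·e₂) + O(h³) and g₂(h) = û(p + h·e₃) + O(h³) as h → 0 (i.e., h ↦ g₁(h) − û(p + h·e₂) is big-O of h³ at 0, and similarly for g₂). Then the combined value g₁(h) + g₂(h) − û(p) satisfies g₁(h) + g₂(h) − û(p) = û(p + h·e₂ + h·e₃) + O(h²) as h → 0; that is, the function h ↦ g₁(h) + g₂(h) − û(p) − û(p + h·e₂ + h·e₃) is big-O of h² at 0. -/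

import Mathlib

open Asymptotics

/-- First-order Taylor expansion with quadratic remainder for a function that is `C²` at a
point. -/
theorem ContDiffAt.isBigO_sub_sub_fderiv {E F : Type*} [NormedAddCommGroup E] [NormedSpace ℝ E]
    [NormedAddCommGroup F] [NormedSpace ℝ F] {f : E → F} {x : E} (hf : ContDiffAt ℝ 2 f x) :
    (fun y => f y - f x - fderiv ℝ f x (y - x)) =O[nhds x] fun y => ‖y - x‖ ^ 2 := by
  have hd : DifferentiableAt ℝ (fderiv ℝ f) x :=
    (hf.fderiv_right (m := 1) (by norm_num)).differentiableAt (by norm_num)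
  obtain ⟨C, hCpos, hC⟩ := hd.isBigO_sub.exists_pos
  have hev : ∀ᶠ y in nhds x, DifferentiableAt ℝ f y :=
    (hf.eventually (by simp)).mono fun y hy => hy.differentiableAt (by norm_num)
  obtain ⟨ε, hε, hball⟩ := Metric.eventually_nhds_iff_ball.1 (hev.and hC.bound)
  refine IsBigO.of_bound C ?_
  filter_upwards [Metric.ball_mem_nhds x hε] with y hy
  have hsub : ∀ z ∈ Metric.closedBall x ‖y - x‖, z ∈ Metric.ball x ε := fun z hz =>
    (Metric.mem_closedBall.1 hz).trans_lt (by rwa [← dist_eq_norm])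
  have key := (convex_closedBall x ‖y - x‖).norm_image_sub_le_of_norm_fderiv_le'
    (𝕜 := ℝ) (f := f) (φ := fderiv ℝ f x) (C := C * ‖y - x‖)
    (fun z hz => (hball z (hsub z hz)).1)
    (fun z hz => (hball z (hsub z hz)).2.trans
      (mul_le_mul_of_nonneg_left (mem_closedBall_iff_norm.1 hz) hCpos.le))
    (Metric.mem_closedBall_self (norm_nonneg _)) (mem_closedBall_iff_norm.2 le_rfl)
  rwa [norm_pow, norm_norm, pow_two, ← mul_assoc]

/-- Along a line through a point where `f` is `C²`, the linearization of `f` is accurate to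
second order. -/
theorem ContDiffAt.isBigO_add_smul_sub_fderiv {E F : Type*} [NormedAddCommGroup E]
    [NormedSpace ℝ E] [NormedAddCommGroup F] [NormedSpace ℝ F] {f : E → F} {x : E}
    (hf : ContDiffAt ℝ 2 f x) (v : E) :
    (fun h : ℝ => f (x + h • v) - f x - h • fderiv ℝ f x v) =O[nhds 0] fun h : ℝ => h ^ 2 := by
  have ht : Filter.Tendsto (fun h : ℝ => x + h • v) (nhds 0) (nhds x) :=
    (by fun_prop : Continuous fun h : ℝ => x + h • v).tendsto' 0 x (by simp)
  have hO := hf.isBigO_sub_sub_fderiv.comp_tendsto ht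
  simp only [Function.comp_def, add_sub_cancel_left, map_smul] at hO
  refine hO.trans (IsBigO.of_bound (‖v‖ ^ 2) (Filter.Eventually.of_forall fun h => ?_))
  rw [norm_pow, norm_norm, norm_smul, norm_pow, mul_pow, mul_comm]

/-- Accuracy of the neighbor-combination scheme: if `g₁` and `g₂` approximate the smooth
extension `uhat` at the axis-neighbor points `p + h•e₂` and `p + h•e₃` to third order in `h`,
then `g₁(h) + g₂(h) - uhat(p)` approximates `uhat` at the diagonal neighbor `p + h•e₂ + h•e₃`
to second order in `h`. -/
theorem neighbor_combination_second_order
    (p : Fin 3 → ℝ) (uhat : (Fin 3 → ℝ) → ℝ)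
    (hu : ContDiffAt ℝ 2 uhat p)
    (g₁ g₂ : ℝ → ℝ)
    (e₂ e₃ : Fin 3 → ℝ)
    (he₂ : e₂ = Pi.single 1 1) (he₃ : e₃ = Pi.single 2 1)
    (hg₁ : (fun h : ℝ => g₁ h - uhat (p + h • e₂)) =O[nhds 0] fun h : ℝ => h ^ 3)
    (hg₂ : (fun h : ℝ => g₂ h - uhat (p + h • e₃)) =O[nhds 0] fun h : ℝ => h ^ 3) :
    (fun h : ℝ => g₁ h + g₂ h - uhat p - uhat (p + h • e₂ + h • e₃)) =O[nhds 0]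
      fun h : ℝ => h ^ 2 := by
  have hcube : (fun h : ℝ => h ^ 3) =O[nhds 0] fun h : ℝ => h ^ 2 :=
    (isLittleO_pow_pow (by norm_num)).isBigO
  refine ((((hg₁.trans hcube).add (hg₂.trans hcube)).add
    ((hu.isBigO_add_smul_sub_fderiv e₂).add (hu.isBigO_add_smul_sub_fderiv e₃))).sub
    (hu.isBigO_add_smul_sub_fderiv (e₂ + e₃))).congr_left fun h => ?_
  simp only [smul_add, map_add, smul_eq_mul, add_assoc]
  ring
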